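/- arXiv:1811.06489 — 2 statements merged into one kernel-verified Lean document; each statement's English description precedes it below -/
import Mathlib

section
/- There is no strongly linked tree forcing P on 2^{<ω} whose induced ideal I_P equals the Lebesgue null ideal. Concretely: if P is a tree forcing such that every I_P-positive Borel set contains [S] mod I_P for some S ∈ P and I_P = (null sets), then P is not strongly linked, as witnessed by a nowhere dense closed set C of positive measure. -/
open Set

noncomputable section

/-- The restriction `x↾n` of `x : ℕ → α` to its first `n` values, as a list. -/
def res {α : Type*} (x : ℕ → α) (n : ℕ) : List α := List.ofFn (fun i : Fin n => x i)

/-- A (set-theoretic) tree on `α`: a collection of finite sequences closed under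
initial segments. -/
def IsTree {α : Type*} (T : Set (List α)) : Prop :=
  ∀ s ∈ T, ∀ t : List α, t <+: s → t ∈ T

/-- The set `[T]` of branches of a tree `T`. -/
def branches {α : Type*} (T : Set (List α)) : Set (ℕ → α) :=
  {x | ∀ n : ℕ, res x n ∈ T}

/-- A perfect tree: a nonempty tree with a splitting node above every node. -/
def IsPerfectTree {α : Type*} (T : Set (List α)) : Prop :=
  IsTree T ∧ T.Nonempty ∧
    ∀ s ∈ T, ∃ t ∈ T, s <+: t ∧ ∃ a b : α, a ≠ b ∧ t ++ [a] ∈ T ∧ t ++ [b] ∈ T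

/-- A tree forcing: a collection of perfect trees containing the full tree and closed
under restriction `T ↦ T_u`. -/
def IsTreeForcing {α : Type*} (P : Set (Set (List α))) : Prop :=
  (∀ T ∈ P, IsPerfectTree T) ∧ Set.univ ∈ P ∧
    ∀ T ∈ P, ∀ u ∈ T, {t ∈ T | u <+: t ∨ t <+: u} ∈ P

/-- `A` is `P`-nowhere dense. -/
def PNwd {α : Type*} (P : Set (Set (List α))) (A : Set (ℕ → α)) : Prop :=
  ∀ T ∈ P, ∃ S ∈ P, S ⊆ T ∧ branches S ∩ A = ∅

/-- `A` belongs to the σ-ideal `I_P` generated by the `P`-nowhere dense sets. -/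
def PIdeal {α : Type*} (P : Set (Set (List α))) (A : Set (ℕ → α)) : Prop :=
  ∃ f : ℕ → Set (ℕ → α), (∀ n, PNwd P (f n)) ∧ A ⊆ ⋃ n, f n

/-- `A` belongs to the auxiliary ideal `I*_P`. -/
def PIstar {α : Type*} (P : Set (Set (List α))) (A : Set (ℕ → α)) : Prop :=
  ∀ T ∈ P, ∃ S ∈ P, S ⊆ T ∧ PIdeal P (branches S ∩ A)

/-- `A` is `P`-measurable. -/
def PMeasurable {α : Type*} (P : Set (Set (List α))) (A : Set (ℕ → α)) : Prop :=
  ∀ T ∈ P, ∃ S ∈ P, S ⊆ T ∧ (PIdeal P (branches S \ A) ∨ PIdeal P (branches S ∩ A))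

/-- Compatibility of two conditions in the tree forcing `P`. -/
def Compat {α : Type*} (P : Set (Set (List α))) (S T : Set (List α)) : Prop :=
  ∃ R ∈ P, R ⊆ S ∧ R ⊆ T

/-- `D` is an antichain in the tree forcing `P`. -/
def IsAntichainIn {α : Type*} (P D : Set (Set (List α))) : Prop :=
  D ⊆ P ∧ ∀ S ∈ D, ∀ T ∈ D, S ≠ T → ¬ Compat P S T

/-- `D` is a maximal antichain in the tree forcing `P`. -/
def IsMaxAntichainIn {α : Type*} (P D : Set (Set (List α))) : Prop :=
  IsAntichainIn P D ∧ ∀ T ∈ P, ∃ S ∈ D, Compat P S T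

/-- `s` is the stem of the tree `T`: the longest node comparable with all nodes of `T`. -/
def IsStem {α : Type*} (T : Set (List α)) (s : List α) : Prop :=
  s ∈ T ∧ (∀ t ∈ T, s <+: t ∨ t <+: s) ∧
    ∀ s' ∈ T, (∀ t ∈ T, s' <+: t ∨ t <+: s') → s'.length ≤ s.length

open MeasureTheory
open scoped ENNReal

/-- The basic clopen cylinder `N_s` of all extensions of the finite string `s`. -/
def Cyl {α : Type*} (s : List α) : Set (ℕ → α) := {x | res x s.length = s}

/-- `P` is strongly linked: any `S, T ∈ P` with `stem(T) ⊑ stem(S)` and `stem(S) ∈ T`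
have a common refinement `R ∈ P` with `R ⊆ S ∩ T`. -/
def StronglyLinked {α : Type*} (P : Set (Set (List α))) : Prop :=
  ∀ S ∈ P, ∀ T ∈ P, ∀ sS sT : List α, IsStem S sS → IsStem T sT →
    sT <+: sS → sS ∈ T → ∃ R ∈ P, R ⊆ S ∩ T

section Trees

variable {α : Type*}

theorem length_res (x : ℕ → α) (n : ℕ) : (res x n).length = n := by simp [res]

theorem getElem_res (x : ℕ → α) (n i : ℕ) (h : i < (res x n).length) : (res x n)[i] = x i := by
  simp [res]

theorem res_prefix_res (x : ℕ → α) {m n : ℕ} (h : m ≤ n) : res x m <+: res x n := by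
  rw [List.prefix_iff_eq_take]
  apply List.ext_getElem
  · simp [length_res, h]
  · intro i h₁ h₂
    simp [getElem_res]

theorem res_succ (x : ℕ → α) (n : ℕ) : res x (n + 1) = res x n ++ [x n] := by
  rw [res, List.ofFn_succ_last]
  simp [res]

theorem mem_cyl_iff_prefix {x : ℕ → α} {s : List α} {n : ℕ} (h : s.length ≤ n) :
    x ∈ Cyl s ↔ s <+: res x n := by
  constructor
  · intro hx
    have hx' : res x s.length = s := hx
    rw [← hx']
    exact res_prefix_res x (by simpa [length_res] using h)
  · intro hs
    exact ((List.prefix_of_prefix_length_le hs (res_prefix_res x h)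
      (by rw [length_res])).eq_of_length (by rw [length_res])).symm

theorem mem_cyl_res (x : ℕ → α) (n : ℕ) : x ∈ Cyl (res x n) := by
  simp [Cyl, length_res]

theorem cyl_anti {s t : List α} (h : s <+: t) : Cyl t ⊆ Cyl s := by
  intro x hx
  rw [mem_cyl_iff_prefix h.length_le]
  exact h.trans ((mem_cyl_iff_prefix le_rfl).1 hx)

theorem prefix_of_mem_cyl {x : ℕ → α} {s t : List α} (hs : x ∈ Cyl s) (ht : x ∈ Cyl t)
    (h : s.length ≤ t.length) : s <+: t := by
  have hs' := (mem_cyl_iff_prefix h).1 hs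
  rwa [show res x t.length = t from ht] at hs'

theorem mem_of_mem_branches {T : Set (List α)} {x : ℕ → α} {s : List α} (hx : x ∈ branches T)
    (hs : x ∈ Cyl s) : s ∈ T := by
  have := hx s.length
  rwa [show res x s.length = s from hs] at this

theorem branches_mono {S T : Set (List α)} (h : S ⊆ T) : branches S ⊆ branches T :=
  fun _ hx n => h (hx n)

theorem mem_cyl_append_singleton {x : ℕ → α} {w : List α} (hx : x ∈ Cyl w) :
    x ∈ Cyl (w ++ [x w.length]) := by
  have h := mem_cyl_res x (w.length + 1)
  rwa [res_succ, show res x w.length = w from hx] at h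

/-- Every node of a perfect tree lies on a branch. -/
theorem IsPerfectTree.exists_branch {T : Set (List α)} (hT : IsPerfectTree T) {w : List α}
    (hw : w ∈ T) : (branches T ∩ Cyl w).Nonempty := by
  obtain ⟨htree, -, hsplit⟩ := hT
  have hstep : ∀ t : T, ∃ b : α, t.1 ++ [b] ∈ T := by
    rintro ⟨t, ht⟩
    obtain ⟨_, -, ⟨r, rfl⟩, a, -, -, ha, -⟩ := hsplit t ht
    cases r with
    | nil => exact ⟨a, by simpa using ha⟩
    | cons c r => exact ⟨c, htree _ ha _ ⟨r ++ [a], by simp⟩⟩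
  choose b hb using hstep
  let s : ℕ → T := fun n => Nat.rec ⟨w, hw⟩ (fun _ t => ⟨t.1 ++ [b t], hb t⟩) n
  have hs : ∀ n, (s (n + 1)).1 = (s n).1 ++ [b (s n)] := fun n => rfl
  have hlen : ∀ n, (s n).1.length = w.length + n := by
    intro n
    induction n with
    | zero => rfl
    | succ n ih => rw [hs, List.length_append, ih]; rfl
  have hmono : ∀ m n, m ≤ n → (s m).1 <+: (s n).1 := by
    intro m n h
    induction n, h using Nat.le_induction with
    | base => exact List.prefix_rfl
    | succ n _ ih => exact ih.trans ⟨_, (hs n).symm⟩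
  let x : ℕ → α := fun i =>
    (s (i + 1)).1[i]'((show i < w.length + (i + 1) by omega).trans_eq (hlen (i + 1)).symm)
  have hx : ∀ n, res x (w.length + n) = (s n).1 := by
    intro n
    apply List.ext_getElem
    · rw [length_res, hlen]
    · intro i h₁ h₂
      rw [getElem_res]
      rcases le_total (i + 1) n with h | h
      · exact (hmono _ _ h).getElem _
      · exact ((hmono _ _ h).getElem _).symm
  refine ⟨x, fun n => ?_, hx 0⟩
  refine htree _ (s n).2 _ ?_
  rw [← hx]
  exact res_prefix_res x (by omega)

/-- Every perfect tree has a stem. -/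
theorem IsPerfectTree.exists_isStem {T : Set (List α)} (hT : IsPerfectTree T) :
    ∃ s, IsStem T s := by
  obtain ⟨htree, ⟨r, hr⟩, hsplit⟩ := hT
  obtain ⟨t, ht, -, a, b, hab, ha, hb⟩ := hsplit r hr
  have hbound : ∀ s, (∀ t ∈ T, s <+: t ∨ t <+: s) → s.length ≤ t.length := by
    intro s hs
    by_contra! hlt
    have key : ∀ c, t ++ [c] ∈ T → t ++ [c] <+: s := by
      intro c hc
      rcases hs _ hc with h | h
      · rw [h.eq_of_length_le (by simpa using hlt)]
      · exact h
    have := List.prefix_of_prefix_length_le (key a ha) (key b hb) (by simp)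
    have := this.eq_of_length (by simp)
    simp at this
    exact hab this
  let p : ℕ → Prop := fun n => ∃ s ∈ T, (∀ t ∈ T, s <+: t ∨ t <+: s) ∧ s.length = n
  have hp : p 0 := ⟨[], htree _ hr _ List.nil_prefix, fun _ _ => Or.inl List.nil_prefix, rfl⟩
  classical
  obtain ⟨s, hsT, hs, hlen⟩ := Nat.findGreatest_spec (P := p) (Nat.zero_le t.length) hp
  refine ⟨s, hsT, hs, fun s' hs'T hs' => ?_⟩
  rw [hlen]
  exact Nat.le_findGreatest (hbound s' hs') ⟨s', hs'T, hs', rfl⟩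

theorem IsStem.branches_subset {T : Set (List α)} {s : List α} (h : IsStem T s) :
    branches T ⊆ Cyl s := by
  intro x hx
  rcases h.2.1 _ (hx s.length) with h' | h'
  · exact (mem_cyl_iff_prefix le_rfl).2 h'
  · exact h'.eq_of_length (length_res _ _)

theorem IsStem.prefix_of_branches_subset {T : Set (List α)} (hT : IsPerfectTree T)
    {s v : List α} (h : IsStem T s) (hv : branches T ⊆ Cyl v) : v <+: s := by
  have hcomp : ∀ t ∈ T, v <+: t ∨ t <+: v := by
    intro t ht
    obtain ⟨x, hx, hxt⟩ := hT.exists_branch ht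
    rcases le_total v.length t.length with hl | hl
    · exact Or.inl (prefix_of_mem_cyl (hv hx) hxt hl)
    · exact Or.inr (prefix_of_mem_cyl hxt (hv hx) hl)
  obtain ⟨x, hx, hxs⟩ := hT.exists_branch h.1
  exact prefix_of_mem_cyl (hv hx) hxs (h.2.2 v (mem_of_mem_branches hx (hv hx)) hcomp)

theorem isStem_univ_nil [Nontrivial α] : IsStem (Set.univ : Set (List α)) [] := by
  refine ⟨Set.mem_univ _, fun _ _ => Or.inl List.nil_prefix, fun s _ hs => ?_⟩
  cases s with
  | nil => rfl
  | cons a s =>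
    obtain ⟨b, hb⟩ := exists_ne a
    rcases hs [b] (Set.mem_univ _) with h | h
    · simp [List.cons_prefix_cons] at h
      exact absurd h.1.symm hb
    · simp [List.cons_prefix_cons] at h
      exact absurd h hb

end Trees

section Cantor

theorem isClopen_setOf_res_mem (n : ℕ) (A : Set (List Bool)) :
    IsClopen {x : ℕ → Bool | res x n ∈ A} :=
  (isClopen_discrete {y : Fin n → Bool | List.ofFn y ∈ A}).preimage
    (f := fun (x : ℕ → Bool) (i : Fin n) => x i) (by fun_prop)

theorem measurableSet_cyl (s : List Bool) : MeasurableSet (Cyl s) :=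
  (isClopen_setOf_res_mem s.length {s}).isOpen.measurableSet

theorem isClosed_branches (T : Set (List Bool)) : IsClosed (branches T) := by
  have : branches T = ⋂ n, {x | res x n ∈ T} := by
    ext x
    simp [branches]
  rw [this]
  exact isClosed_iInter fun n => (isClopen_setOf_res_mem n T).isClosed

theorem exists_disjoint_cyl_res {B : Set (ℕ → Bool)} (hB : IsClosed B) {x : ℕ → Bool}
    (hx : x ∉ B) : ∃ n, Disjoint (Cyl (res x n)) B := by
  obtain ⟨I, u, hu, hsub⟩ := isOpen_pi_iff.1 hB.isOpen_compl x hx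
  refine ⟨I.sup id + 1, Set.disjoint_left.2 fun y hy => hsub fun i hi => ?_⟩
  have hi' : i < I.sup id + 1 := Nat.lt_succ_of_le (Finset.le_sup (f := id) hi)
  have h : res y (I.sup id + 1) = res x (I.sup id + 1) := by
    have : res y (res x (I.sup id + 1)).length = _ := hy
    rwa [length_res] at this
  have h' : y i = x i := by
    rw [← getElem_res y (I.sup id + 1) i (by rwa [length_res]),
      ← getElem_res x (I.sup id + 1) i (by rwa [length_res])]
    simp only [h]
  rw [h']
  exact (hu i hi).2

/-- A closed set which is not in `I_P` contains all branches of some condition. -/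
theorem IsTreeForcing.exists_branches_subset {P : Set (Set (List Bool))} (hP : IsTreeForcing P)
    {B : Set (ℕ → Bool)} (hB : IsClosed B) (hpos : ¬ PIdeal P B) :
    ∃ T ∈ P, branches T ⊆ B := by
  have hnwd : ¬ PNwd P B := fun h => hpos ⟨fun _ => B, fun _ => h, fun x hx => by simpa using hx⟩
  simp only [PNwd, not_forall, not_exists, not_and] at hnwd
  obtain ⟨T, hT, hmeet⟩ := hnwd
  refine ⟨T, hT, fun x hx => ?_⟩
  by_contra hxB
  obtain ⟨n, hn⟩ := exists_disjoint_cyl_res hB hxB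
  refine hmeet _ (hP.2.2 T hT (res x n) (hx n)) (fun t ht => ht.1) ?_
  refine Set.disjoint_iff_inter_eq_empty.1 (hn.mono_left fun y hy => ?_)
  rcases (hy n).2 with h | h
  · exact (mem_cyl_iff_prefix (by rw [length_res])).2 h
  · have := h.eq_of_length (by simp [length_res])
    rw [← this]
    exact mem_cyl_res y n

end Cantor

section Killing

/-- The conditions passing through the node `w` whose stem is an initial segment of `w`. -/
def Through (P : Set (Set (List Bool))) (w : List Bool) : Set (Set (List Bool)) :=
  {S | S ∈ P ∧ w ∈ S ∧ ∃ s, IsStem S s ∧ s <+: w}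

/-- `F` meets every condition of `Through P w` inside the cylinder of `w`. -/
def Kills (P : Set (Set (List Bool))) (w : List Bool) (F : Set (ℕ → Bool)) : Prop :=
  ∀ R ∈ Through P w, (branches R ∩ Cyl w ∩ F).Nonempty

/-- Every condition of `Through P w` avoiding `F` inside the cylinder of `w` has all its branches
through `w` passing through `w ++ z`. -/
def Confines (P : Set (Set (List Bool))) (w z : List Bool) (F : Set (ℕ → Bool)) : Prop :=
  ∀ R ∈ Through P w, branches R ∩ Cyl w ∩ F = ∅ → branches R ∩ Cyl w ⊆ Cyl (w ++ z)

/-- The least measure of a set killing `w`. -/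
def killCost (μ : Measure (ℕ → Bool)) (P : Set (Set (List Bool))) (w : List Bool) : ℝ≥0∞ :=
  sInf {r | ∃ F, Kills P w F ∧ r = μ F}

/-- The least measure of a set confining `w` to a cylinder `l` levels higher. -/
def confineCost (μ : Measure (ℕ → Bool)) (P : Set (Set (List Bool))) (l : ℕ) (w : List Bool) :
    ℝ≥0∞ :=
  sInf {r | ∃ F z, z.length = l ∧ Confines P w z F ∧ r = μ F}

/-- The least measure, inside the cylinder of `w`, of a condition of `Through P w`. -/
def throughCost (μ : Measure (ℕ → Bool)) (P : Set (Set (List Bool))) (w : List Bool) : ℝ≥0∞ :=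
  sInf {r | ∃ S ∈ Through P w, r = μ (branches S ∩ Cyl w)}

variable {μ : Measure (ℕ → Bool)} {P : Set (Set (List Bool))}

theorem Through.extend {w u : List Bool} {R : Set (List Bool)} (hR : R ∈ Through P w)
    (h : w <+: u) (hu : u ∈ R) : R ∈ Through P u := by
  obtain ⟨hRP, -, s, hs, hsw⟩ := hR
  exact ⟨hRP, hu, s, hs, hsw.trans h⟩

theorem Kills.mono {w : List Bool} {F G : Set (ℕ → Bool)} (h : Kills P w F) (hFG : F ⊆ G) :
    Kills P w G := fun R hR => (h R hR).mono (Set.inter_subset_inter_right _ hFG)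

theorem Kills.notMem {w u : List Bool} {F : Set (ℕ → Bool)} (h : Kills P u F)
    {R : Set (List Bool)} (hR : R ∈ Through P w) (hwu : w <+: u)
    (hF : branches R ∩ Cyl w ∩ F = ∅) : u ∉ R := by
  intro hu
  obtain ⟨x, ⟨hxR, hxu⟩, hxF⟩ := h R (Through.extend hR hwu hu)
  exact Set.eq_empty_iff_forall_notMem.1 hF x ⟨⟨hxR, cyl_anti hwu hxu⟩, hxF⟩

theorem kills_cyl (hP : IsTreeForcing P) (w : List Bool) : Kills P w (Cyl w) := by
  intro R hR
  obtain ⟨x, hx⟩ := (hP.1 R hR.1).exists_branch hR.2.1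
  exact ⟨x, hx, hx.2⟩

theorem killCost_le {w : List Bool} {F : Set (ℕ → Bool)} (h : Kills P w F) :
    killCost μ P w ≤ μ F := sInf_le ⟨F, h, rfl⟩

theorem exists_kills_of_killCost_lt {w : List Bool} {r : ℝ≥0∞} (h : killCost μ P w < r) :
    ∃ F, Kills P w F ∧ μ F < r := by
  obtain ⟨_, ⟨F, hF, rfl⟩, hr⟩ := sInf_lt_iff.1 h
  exact ⟨F, hF, hr⟩

theorem exists_confines_of_confineCost_lt {l : ℕ} {w : List Bool} {r : ℝ≥0∞}
    (h : confineCost μ P l w < r) :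
    ∃ F z, z.length = l ∧ Confines P w z F ∧ μ F < r := by
  obtain ⟨_, ⟨F, z, hz, hF, rfl⟩, hr⟩ := sInf_lt_iff.1 h
  exact ⟨F, z, hz, hF, hr⟩

theorem exists_through_of_throughCost_lt {w : List Bool} {r : ℝ≥0∞}
    (h : throughCost μ P w < r) :
    ∃ S ∈ Through P w, μ (branches S ∩ Cyl w) < r := by
  obtain ⟨_, ⟨S, hS, rfl⟩, hr⟩ := sInf_lt_iff.1 h
  exact ⟨S, hS, hr⟩

theorem univ_mem_through (hP : IsTreeForcing P) (w : List Bool) : Set.univ ∈ Through P w :=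
  ⟨hP.2.1, Set.mem_univ _, [], isStem_univ_nil, List.nil_prefix⟩

theorem throughCost_le_cyl (hP : IsTreeForcing P) (w : List Bool) :
    throughCost μ P w ≤ μ (Cyl w) :=
  have h : throughCost μ P w ≤ μ (branches Set.univ ∩ Cyl w) :=
    sInf_le ⟨_, univ_mem_through hP w, rfl⟩
  h.trans (measure_mono Set.inter_subset_right)

theorem killCost_le_cyl (hP : IsTreeForcing P) (w : List Bool) : killCost μ P w ≤ μ (Cyl w) :=
  killCost_le (kills_cyl hP w)

theorem confineCost_le_cyl (hP : IsTreeForcing P) (l : ℕ) (w : List Bool) :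
    confineCost μ P l w ≤ μ (Cyl w) := by
  refine sInf_le ⟨Cyl w, List.replicate l true, by simp, fun R hR h => ?_, rfl⟩
  exact absurd h (kills_cyl hP w R hR).ne_empty

theorem confineCost_zero (w : List Bool) : confineCost μ P 0 w = 0 := by
  have h : Confines P w [] ∅ := fun R _ _ => by simp
  exact le_antisymm (sInf_le ⟨∅, [], rfl, h, by simp⟩) zero_le

/-- To kill `w` it is enough to kill a family of extensions and to remove what they do not
cover. -/
theorem killCost_le_tsum (hP : IsTreeForcing P) (w : List Bool) {ι : Type*} [Countable ι]
    (u : ι → List Bool) (hu : ∀ i, w <+: u i) :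
    killCost μ P w ≤ (∑' i, killCost μ P (u i)) + μ (Cyl w \ ⋃ i, Cyl (u i)) := by
  refine ENNReal.le_of_forall_pos_le_add fun ε hε hfin => ?_
  have hsum : ∑' i, killCost μ P (u i) ≠ ∞ := fun h => by simp [h] at hfin
  obtain ⟨ε', hε', hε'sum⟩ := ENNReal.exists_pos_sum_of_countable'
    (ENNReal.coe_ne_zero.2 hε.ne') ι
  have hlt : ∀ i, killCost μ P (u i) < killCost μ P (u i) + ε' i := fun i =>
    ENNReal.lt_add_right (ENNReal.ne_top_of_tsum_ne_top hsum i) (hε' i).ne'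
  choose F hF hFμ using fun i => exists_kills_of_killCost_lt (hlt i)
  have hkill : Kills P w ((⋃ i, F i) ∪ (Cyl w \ ⋃ i, Cyl (u i))) := by
    intro R hR
    by_contra hempty
    rw [Set.not_nonempty_iff_eq_empty] at hempty
    obtain ⟨x, hxR, hxw⟩ := (hP.1 R hR.1).exists_branch hR.2.1
    by_cases hx : x ∈ ⋃ i, Cyl (u i)
    · obtain ⟨i, hi⟩ := Set.mem_iUnion.1 hx
      exact ((hF i).mono (Set.subset_union_of_subset_left (Set.subset_iUnion F i) _)).notMem
        hR (hu i) hempty (mem_of_mem_branches hxR hi)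
    · exact Set.eq_empty_iff_forall_notMem.1 hempty x ⟨⟨hxR, hxw⟩, Or.inr ⟨hxw, hx⟩⟩
  calc killCost μ P w ≤ μ ((⋃ i, F i) ∪ (Cyl w \ ⋃ i, Cyl (u i))) := killCost_le hkill
    _ ≤ (∑' i, (killCost μ P (u i) + ε' i)) + μ (Cyl w \ ⋃ i, Cyl (u i)) :=
      (measure_union_le _ _).trans (add_le_add_left
        ((measure_iUnion_le F).trans (ENNReal.tsum_le_tsum fun i => (hFμ i).le)) _)
    _ ≤ _ := by
      rw [ENNReal.tsum_add, add_right_comm]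
      gcongr

theorem killCost_le_add (hP : IsTreeForcing P) (w : List Bool) :
    killCost μ P w ≤ killCost μ P (w ++ [false]) + killCost μ P (w ++ [true]) := by
  have h := killCost_le_tsum (μ := μ) hP w (fun b : Bool => w ++ [b])
    fun b => List.prefix_append _ _
  have hempty : Cyl w \ ⋃ b : Bool, Cyl (w ++ [b]) = ∅ := by
    rw [Set.sdiff_eq_empty]
    intro x hx
    exact Set.mem_iUnion.2 ⟨_, mem_cyl_append_singleton hx⟩
  rw [hempty, measure_empty, add_zero, tsum_fintype, Fintype.sum_bool, add_comm] at h
  exact h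

theorem confineCost_succ_le (l : ℕ) (w : List Bool) (b : Bool) :
    confineCost μ P (l + 1) w ≤ killCost μ P (w ++ [!b]) + confineCost μ P l (w ++ [b]) := by
  refine ENNReal.le_of_forall_pos_le_add fun ε hε hfin => ?_
  have hε2 : (ε / 2 : ℝ≥0∞) ≠ 0 := by simp [hε.ne']
  obtain ⟨h₁, h₂⟩ := ENNReal.add_lt_top.1 hfin
  obtain ⟨F, hF, hFμ⟩ := exists_kills_of_killCost_lt (ENNReal.lt_add_right h₁.ne hε2)
  obtain ⟨G, z, hz, hG, hGμ⟩ := exists_confines_of_confineCost_lt (ENNReal.lt_add_right h₂.ne hε2)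
  have hconf : Confines P w (b :: z) (F ∪ G) := by
    intro R hR hempty x hx
    have hnot : w ++ [!b] ∉ R :=
      (hF.mono Set.subset_union_left).notMem hR (List.prefix_append _ _) hempty
    have hxb : x ∈ Cyl (w ++ [b]) := by
      have hc := mem_cyl_append_singleton hx.2
      have hb : x w.length = b := by
        by_contra hne
        rw [Bool.eq_not_of_ne hne] at hc
        exact hnot (mem_of_mem_branches hx.1 hc)
      rwa [hb] at hc
    have hsub : branches R ∩ Cyl (w ++ [b]) ∩ G ⊆ branches R ∩ Cyl w ∩ (F ∪ G) :=
      Set.inter_subset_inter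
        (Set.inter_subset_inter_right _ (cyl_anti (List.prefix_append _ _)))
        Set.subset_union_right
    have := hG R (Through.extend hR (List.prefix_append _ _) (mem_of_mem_branches hx.1 hxb))
      (Set.subset_empty_iff.1 (hsub.trans hempty.subset)) ⟨hx.1, hxb⟩
    simpa using this
  calc confineCost μ P (l + 1) w ≤ μ (F ∪ G) := sInf_le ⟨_, b :: z, by simp [hz], hconf, rfl⟩
    _ ≤ μ F + μ G := measure_union_le _ _
    _ ≤ (killCost μ P (w ++ [!b]) + ε / 2) + (confineCost μ P l (w ++ [b]) + ε / 2) :=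
      add_le_add hFμ.le hGμ.le
    _ = _ := by
      rw [add_add_add_comm, ENNReal.add_halves]

/-- If every condition through `w` is larger than the cylinders `l` levels higher, then confining
`w` to one of these cylinders already kills it. -/
theorem killCost_le_confineCost (l : ℕ) (w : List Bool)
    (h : ∀ z : List Bool, z.length = l → μ (Cyl (w ++ z)) < throughCost μ P w) :
    killCost μ P w ≤ confineCost μ P l w := by
  refine le_sInf ?_
  rintro _ ⟨F, z, hz, hF, rfl⟩
  refine killCost_le fun R hR => ?_
  by_contra hempty
  rw [Set.not_nonempty_iff_eq_empty] at hempty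
  exact ((h z hz).trans_le (sInf_le ⟨R, hR, rfl⟩)).not_ge (measure_mono (hF R hR hempty))

end Killing

section LevelSums

/-- The sum of `f` over all strings of length `n`. -/
def levelSum (n : ℕ) (f : List Bool → ℝ≥0∞) : ℝ≥0∞ :=
  ∑' w, if w.length = n then f w else 0

theorem levelSum_mono {f g : List Bool → ℝ≥0∞} (h : ∀ w, f w ≤ g w) (n : ℕ) :
    levelSum n f ≤ levelSum n g :=
  ENNReal.tsum_le_tsum fun w => by split_ifs <;> simp [h]

theorem levelSum_add (n : ℕ) (f g : List Bool → ℝ≥0∞) :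
    levelSum n (fun w => f w + g w) = levelSum n f + levelSum n g := by
  rw [levelSum, levelSum, levelSum, ← ENNReal.tsum_add]
  exact tsum_congr fun w => by split_ifs <;> simp

theorem levelSum_const_mul (n : ℕ) (c : ℝ≥0∞) (f : List Bool → ℝ≥0∞) :
    levelSum n (fun w => c * f w) = c * levelSum n f := by
  rw [levelSum, levelSum, ← ENNReal.tsum_mul_left]
  exact tsum_congr fun w => by split_ifs <;> simp

theorem levelSum_succ (n : ℕ) (f : List Bool → ℝ≥0∞) :
    levelSum (n + 1) f = levelSum n fun w => f (w ++ [false]) + f (w ++ [true]) := by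
  have hinj : Function.Injective fun p : List Bool × Bool => p.1 ++ [p.2] := by
    rintro ⟨w, b⟩ ⟨w', b'⟩ h
    simpa using h
  rw [levelSum, levelSum, ← hinj.tsum_eq, ENNReal.tsum_prod']
  · refine tsum_congr fun w => ?_
    rw [tsum_fintype, Fintype.sum_bool]
    by_cases h : w.length = n <;> simp [h, add_comm]
  · intro w hw
    rcases List.eq_nil_or_concat w with rfl | ⟨u, b, rfl⟩
    · simp at hw
    · exact ⟨(u, b), by simp⟩

theorem levelSum_half_pow (n : ℕ) :
    levelSum n (fun w => (1 / 2 : ℝ≥0∞) ^ w.length) = 1 := by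
  induction n with
  | zero =>
    rw [levelSum, tsum_eq_single [] fun w hw => by simp [hw]]
    simp
  | succ n ih =>
    rw [levelSum_succ]
    refine Eq.trans ?_ ih
    congr 1
    funext w
    simp only [List.length_append, List.length_singleton, pow_succ, ← mul_add, one_div,
      ENNReal.inv_two_add_inv_two, mul_one]

theorem tsum_levelSum (f : List Bool → ℝ≥0∞) : ∑' n, levelSum n f = ∑' w, f w := by
  simp only [levelSum]
  rw [ENNReal.tsum_comm]
  exact tsum_congr fun w => by
    rw [tsum_eq_single w.length fun n hn => by simp [hn.symm]]
    simp

end LevelSums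

section Estimate

variable {μ : Measure (ℕ → Bool)} {P : Set (Set (List Bool))}

/-- The supremum over `l` of the cost of confining `w` to a cylinder `l` levels higher plus the
proportional part of the cost of killing `w`. -/
def killPotential (μ : Measure (ℕ → Bool)) (P : Set (Set (List Bool))) (w : List Bool) : ℝ≥0∞ :=
  ⨆ l : ℕ, (confineCost μ P l w + (1 / 2) ^ l * killCost μ P w)

theorem killCost_le_killPotential (w : List Bool) : killCost μ P w ≤ killPotential μ P w := by
  refine le_trans ?_ (le_iSup _ 0)
  simp

theorem killPotential_le (hP : IsTreeForcing P) (w : List Bool) :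
    killPotential μ P w ≤ 2 * μ (Cyl w) := by
  refine iSup_le fun l => ?_
  rw [two_mul]
  refine add_le_add (confineCost_le_cyl hP l w) ?_
  calc (1 / 2 : ℝ≥0∞) ^ l * killCost μ P w ≤ 1 * killCost μ P w := by
        gcongr
        exact pow_le_one₀ zero_le (by simp)
    _ ≤ _ := by rw [one_mul]; exact killCost_le_cyl hP w

theorem two_mul_killPotential_le (hP : IsTreeForcing P) (w : List Bool) :
    2 * killPotential μ P w ≤
      (killCost μ P (w ++ [false]) + killPotential μ P (w ++ [false])) +
        (killCost μ P (w ++ [true]) + killPotential μ P (w ++ [true])) := by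
  rw [killPotential, ENNReal.mul_iSup]
  refine iSup_le fun l => ?_
  have hadd := killCost_le_add (μ := μ) hP w
  cases l with
  | zero =>
    rw [confineCost_zero, pow_zero, one_mul, zero_add, two_mul]
    calc _ ≤ _ := add_le_add hadd (hadd.trans (add_le_add
          (killCost_le_killPotential _) (killCost_le_killPotential _)))
      _ = _ := add_add_add_comm _ _ _ _
  | succ l =>
    have h₁ := confineCost_succ_le (μ := μ) (P := P) l w true
    have h₂ := confineCost_succ_le (μ := μ) (P := P) l w false
    have hpow : 2 * ((1 / 2 : ℝ≥0∞) ^ (l + 1) * killCost μ P w) =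
        (1 / 2) ^ l * killCost μ P w := by
      rw [pow_succ, one_div, ← mul_assoc, mul_left_comm, ENNReal.mul_inv_cancel (by simp) (by simp),
        mul_one]
    have hH : ∀ u, confineCost μ P l u + (1 / 2) ^ l * killCost μ P u ≤ killPotential μ P u :=
      fun u => le_iSup (fun l => confineCost μ P l u + (1 / 2) ^ l * killCost μ P u) l
    simp only [Bool.not_true, Bool.not_false] at h₁ h₂
    calc 2 * (confineCost μ P (l + 1) w + (1 / 2) ^ (l + 1) * killCost μ P w)
        = (confineCost μ P (l + 1) w + confineCost μ P (l + 1) w) +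
            (1 / 2) ^ l * killCost μ P w := by rw [mul_add, hpow, two_mul]
      _ ≤ ((killCost μ P (w ++ [false]) + confineCost μ P l (w ++ [true])) +
            (killCost μ P (w ++ [true]) + confineCost μ P l (w ++ [false]))) +
            (1 / 2) ^ l * (killCost μ P (w ++ [false]) + killCost μ P (w ++ [true])) := by
          gcongr
      _ = (killCost μ P (w ++ [false]) + (confineCost μ P l (w ++ [false]) +
            (1 / 2) ^ l * killCost μ P (w ++ [false]))) +
          (killCost μ P (w ++ [true]) + (confineCost μ P l (w ++ [true]) +
            (1 / 2) ^ l * killCost μ P (w ++ [true]))) := by ring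
      _ ≤ _ := by gcongr <;> exact hH _

theorem throughCost_mul_add_killCost_le
    (hμ : ∀ s : List Bool, μ (Cyl s) = (1 / 2 : ℝ≥0∞) ^ s.length) (hP : IsTreeForcing P)
    (w : List Bool) :
    throughCost μ P w * 2 ^ w.length * (1 / 2) * killCost μ P w + killCost μ P w ≤
      killPotential μ P w := by
  by_cases h0 : throughCost μ P w = 0
  · simpa [h0] using killCost_le_killPotential w
  have hex : ∃ l : ℕ, (1 / 2 : ℝ≥0∞) ^ (w.length + l) < throughCost μ P w := by
    obtain ⟨l, hl⟩ := ENNReal.exists_inv_two_pow_lt h0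
    refine ⟨l, lt_of_le_of_lt ?_ hl⟩
    rw [one_div]
    exact pow_le_pow_of_le_one zero_le (by simp) (by omega)
  classical
  let l := Nat.find hex
  have hl : (1 / 2 : ℝ≥0∞) ^ (w.length + l) < throughCost μ P w := Nat.find_spec hex
  have hl0 : l ≠ 0 := by
    intro h
    rw [h, add_zero, ← hμ] at hl
    exact hl.not_ge (throughCost_le_cyl hP w)
  obtain ⟨m, hm⟩ := Nat.exists_eq_succ_of_ne_zero hl0
  have hm' : throughCost μ P w ≤ (1 / 2 : ℝ≥0∞) ^ (w.length + m) :=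
    not_lt.1 (Nat.find_min hex (show m < l by omega))
  have hpow : throughCost μ P w * 2 ^ w.length * (1 / 2) ≤ (1 / 2) ^ l := by
    calc throughCost μ P w * 2 ^ w.length * (1 / 2)
        ≤ (1 / 2) ^ (w.length + m) * 2 ^ w.length * (1 / 2) := by gcongr
      _ = ((1 / 2) ^ w.length * 2 ^ w.length) * (1 / 2) ^ (m + 1) := by ring
      _ = (1 / 2) ^ l := by
        rw [← mul_pow, one_div, ENNReal.inv_mul_cancel (by simp) (by simp), one_pow, one_mul, hm]
  have hkill : killCost μ P w ≤ confineCost μ P l w :=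
    killCost_le_confineCost l w fun z hz => by
      rw [hμ, List.length_append, hz]
      exact hl
  calc _ ≤ (1 / 2) ^ l * killCost μ P w + confineCost μ P l w := by gcongr
    _ = confineCost μ P l w + (1 / 2) ^ l * killCost μ P w := add_comm _ _
    _ ≤ _ := le_iSup (fun l => confineCost μ P l w + (1 / 2) ^ l * killCost μ P w) l

theorem tsum_throughCost_mul_killCost_le
    (hμ : ∀ s : List Bool, μ (Cyl s) = (1 / 2 : ℝ≥0∞) ^ s.length) (hP : IsTreeForcing P) :
    ∑' w : List Bool, throughCost μ P w * 2 ^ w.length * (1 / 2) * killCost μ P w ≤ 3 := by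
  set D : List Bool → ℝ≥0∞ := fun w => throughCost μ P w * 2 ^ w.length * (1 / 2) * killCost μ P w
  set C : List Bool → ℝ≥0∞ := killCost μ P
  set H : List Bool → ℝ≥0∞ := killPotential μ P
  have hC : ∀ n, levelSum n C ≤ 1 := fun n => by
    rw [← levelSum_half_pow n]
    exact levelSum_mono (fun w => (killCost_le_cyl hP w).trans_eq (hμ w)) n
  have hH : ∀ n, levelSum n H ≤ 2 := fun n => by
    calc levelSum n H ≤ levelSum n fun w => 2 * (1 / 2 : ℝ≥0∞) ^ w.length :=
          levelSum_mono (fun w => (killPotential_le hP w).trans_eq (by rw [hμ])) n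
      _ = 2 := by rw [levelSum_const_mul, levelSum_half_pow, mul_one]
  have hstep : ∀ n, levelSum n D + (levelSum n C + levelSum n H) ≤
      levelSum (n + 1) C + levelSum (n + 1) H := fun n => by
    calc levelSum n D + (levelSum n C + levelSum n H)
        = levelSum n (fun w => D w + C w + H w) := by
          rw [levelSum_add n (fun w => D w + C w) H, levelSum_add, add_assoc]
      _ ≤ levelSum n (fun w => (C (w ++ [false]) + H (w ++ [false])) +
            (C (w ++ [true]) + H (w ++ [true]))) :=
          levelSum_mono (fun w => (add_le_add_left
            (throughCost_mul_add_killCost_le hμ hP w) _).trans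
              ((two_mul _).symm.trans_le (two_mul_killPotential_le hP w))) n
      _ = levelSum (n + 1) (fun w => C w + H w) := (levelSum_succ n fun w => C w + H w).symm
      _ = _ := levelSum_add _ _ _
  have hsum : ∀ n, ∑ k ∈ Finset.range n, levelSum k D ≤ levelSum n C + levelSum n H := by
    intro n
    induction n with
    | zero => simp
    | succ n ih =>
      rw [Finset.sum_range_succ, add_comm]
      exact (add_le_add_right ih _).trans (hstep n)
  rw [← tsum_levelSum]
  refine ENNReal.tsum_le_of_sum_range_le fun n => (hsum n).trans ?_
  calc levelSum n C + levelSum n H ≤ 1 + 2 := add_le_add (hC n) (hH n)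
    _ = 3 := by norm_num

end Estimate

section Main

variable {μ : Measure (ℕ → Bool)} {P : Set (Set (List Bool))}

theorem StronglyLinked.branches_inter_nonempty (hP : IsTreeForcing P) (hlink : StronglyLinked P)
    {R S : Set (List Bool)} {s : List Bool} (hR : R ∈ P) (hs : IsStem R s) (hS : S ∈ Through P s) :
    (branches R ∩ (branches S ∩ Cyl s)).Nonempty := by
  obtain ⟨hSP, hsS, t, ht, hts⟩ := hS
  obtain ⟨Q, hQ, hQsub⟩ := hlink R hR S hSP s t hs ht hts hsS
  obtain ⟨q, hq⟩ := (hP.1 Q hQ).2.1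
  obtain ⟨x, hx, -⟩ := (hP.1 Q hQ).exists_branch hq
  have hxR := branches_mono (hQsub.trans Set.inter_subset_left) hx
  exact ⟨x, hxR, branches_mono (hQsub.trans Set.inter_subset_right) hx, hs.branches_subset hxR⟩

/-- A non-null measurable set contains all branches of some condition with an arbitrarily long
stem. -/
theorem exists_isStem_branches_subset [IsFiniteMeasure μ] (hP : IsTreeForcing P)
    (hnull : ∀ A : Set (ℕ → Bool), PIdeal P A ↔ μ A = 0) {E : Set (ℕ → Bool)}
    (hE : MeasurableSet E) (hpos : μ E ≠ 0) (n : ℕ) :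
    ∃ R ∈ P, ∃ s, IsStem R s ∧ n ≤ s.length ∧ branches R ⊆ E := by
  have hcover : E ⊆ ⋃ v : {v : List Bool // v.length = n}, E ∩ Cyl v.1 := fun x hx =>
    Set.mem_iUnion.2 ⟨⟨res x n, length_res x n⟩, hx, mem_cyl_res x n⟩
  obtain ⟨⟨v, rfl⟩, hv⟩ : ∃ v : {v : List Bool // v.length = n}, μ (E ∩ Cyl v.1) ≠ 0 := by
    by_contra! h
    exact hpos (measure_mono_null hcover (measure_iUnion_null h))
  obtain ⟨K, hKsub, hK, hKpos⟩ := (hE.inter (measurableSet_cyl v)).exists_lt_isClosed_of_ne_top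
    (measure_ne_top μ _) (pos_iff_ne_zero.2 hv)
  obtain ⟨R, hR, hRK⟩ := hP.exists_branches_subset hK fun h => hKpos.ne' ((hnull K).1 h)
  obtain ⟨s, hs⟩ := (hP.1 R hR).exists_isStem
  refine ⟨R, hR, s, hs, ?_, fun x hx => (hKsub (hRK hx)).1⟩
  exact (hs.prefix_of_branches_subset (hP.1 R hR) fun x hx => (hKsub (hRK hx)).2).length_le

/-- Some node cannot be killed by null sets. -/
theorem exists_killCost_ne_zero [IsProbabilityMeasure μ] (hP : IsTreeForcing P)
    (hnull : ∀ A : Set (ℕ → Bool), PIdeal P A ↔ μ A = 0) : ∃ v, killCost μ P v ≠ 0 := by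
  by_contra! hzero
  obtain ⟨ε, hε, hεsum⟩ := ENNReal.exists_pos_sum_of_countable' (one_ne_zero) (List Bool)
  choose F hF hFμ using fun w => exists_kills_of_killCost_lt ((hzero w).trans_lt (hε w))
  have hlt : μ (⋃ w, toMeasurable μ (F w)) < 1 :=
    calc μ (⋃ w, toMeasurable μ (F w)) ≤ ∑' w, μ (toMeasurable μ (F w)) := measure_iUnion_le _
      _ ≤ ∑' w, ε w := ENNReal.tsum_le_tsum fun w => by
        rw [measure_toMeasurable]
        exact (hFμ w).le
      _ < 1 := hεsum
  have hmeas : MeasurableSet (⋃ w, toMeasurable μ (F w)) :=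
    MeasurableSet.iUnion fun w => measurableSet_toMeasurable _ _
  have hpos : μ (⋃ w, toMeasurable μ (F w))ᶜ ≠ 0 := fun h =>
    hlt.ne ((prob_compl_eq_zero_iff hmeas).1 h)
  obtain ⟨R, hR, s, hs, -, hsub⟩ := exists_isStem_branches_subset hP hnull hmeas.compl hpos 0
  obtain ⟨x, ⟨hxR, -⟩, hxF⟩ := hF s R ⟨hR, hs.1, s, hs, List.prefix_rfl⟩
  exact hsub hxR (Set.mem_iUnion.2 ⟨s, subset_toMeasurable _ _ hxF⟩)

/-- If killing `v` costs more than the fraction `r` of its cylinder, then the extensions of `v`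
cheaper than the fraction `r` do not cover almost all of this cylinder. -/
theorem measure_cyl_diff_iUnion_ne_zero (hP : IsTreeForcing P) {r : ℝ≥0∞} {v : List Bool}
    (hv : r * μ (Cyl v) < killCost μ P v) :
    μ (Cyl v \ ⋃ u : {u : List Bool // v <+: u ∧ killCost μ P u < r * μ (Cyl u)}, Cyl u.1) ≠ 0 := by
  intro hnull
  let I : Set (List Bool) := {u | (v <+: u ∧ killCost μ P u < r * μ (Cyl u)) ∧
    ∀ t, v <+: t ∧ killCost μ P t < r * μ (Cyl t) → t <+: u → u.length ≤ t.length}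
  have hcover : (⋃ u : {u : List Bool // v <+: u ∧ killCost μ P u < r * μ (Cyl u)}, Cyl u.1) ⊆
      ⋃ u : I, Cyl u.1 := by
    intro x hx
    obtain ⟨⟨u, hu⟩, hxu⟩ := Set.mem_iUnion.1 hx
    have hex : ∃ n, v <+: res x n ∧ killCost μ P (res x n) < r * μ (Cyl (res x n)) :=
      ⟨u.length, by rwa [show res x u.length = u from hxu]⟩
    classical
    refine Set.mem_iUnion.2 ⟨⟨res x (Nat.find hex), Nat.find_spec hex, fun t ht htx => ?_⟩,
      mem_cyl_res _ _⟩
    rw [length_res]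
    refine Nat.find_min' hex ?_
    have hxt : res x t.length = t := cyl_anti htx (mem_cyl_res x _)
    rwa [hxt]
  have hdisj : Pairwise (Function.onFun Disjoint fun u : I => Cyl u.1) := by
    have key : ∀ u ∈ I, ∀ t ∈ I, ∀ x ∈ Cyl u, x ∈ Cyl t → u.length ≤ t.length → u = t :=
      fun u hu t ht x hxu hxt hle =>
        (prefix_of_mem_cyl hxu hxt hle).eq_of_length_le
          (ht.2 u hu.1 (prefix_of_mem_cyl hxu hxt hle))
    intro u t hut
    refine Set.disjoint_left.2 fun x hxu hxt => hut (Subtype.ext ?_)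
    rcases le_total u.1.length t.1.length with h | h
    · exact key _ u.2 _ t.2 x hxu hxt h
    · exact (key _ t.2 _ u.2 x hxt hxu h).symm
  refine hv.not_ge ?_
  calc killCost μ P v
      ≤ (∑' u : I, killCost μ P u.1) + μ (Cyl v \ ⋃ u : I, Cyl u.1) :=
        killCost_le_tsum hP v (fun u : I => u.1) fun u => u.2.1.1
    _ = ∑' u : I, killCost μ P u.1 := by
        rw [measure_mono_null (Set.sdiff_subset_sdiff_right hcover) hnull, add_zero]
    _ ≤ ∑' u : I, r * μ (Cyl u.1) := ENNReal.tsum_le_tsum fun u => u.2.1.2.le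
    _ = r * μ (⋃ u : I, Cyl u.1) := by
        rw [ENNReal.tsum_mul_left, measure_iUnion hdisj fun u => measurableSet_cyl _]
    _ ≤ r * μ (Cyl v) := by
        gcongr
        exact Set.iUnion_subset fun u => cyl_anti u.2.1.1

/-- The nodes expensive to kill have summable `throughCost`. -/
theorem tsum_throughCost_ne_top
    (hμ : ∀ s : List Bool, μ (Cyl s) = (1 / 2 : ℝ≥0∞) ^ s.length) (hP : IsTreeForcing P)
    {r : ℝ≥0∞} (hr : r ≠ 0) :
    ∑' w : {w : List Bool // r * μ (Cyl w) ≤ killCost μ P w}, throughCost μ P w.1 ≠ ∞ := by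
  intro htop
  have hle : ∑' w : {w : List Bool // r * μ (Cyl w) ≤ killCost μ P w},
      (r / 2) * throughCost μ P w.1 ≤ 3 := by
    refine le_trans (ENNReal.tsum_le_tsum fun w => ?_) ((ENNReal.tsum_comp_le_tsum_of_injective
      Subtype.val_injective _).trans (tsum_throughCost_mul_killCost_le hμ hP))
    obtain ⟨w, hw⟩ := w
    rw [hμ] at hw
    calc r / 2 * throughCost μ P w
        = throughCost μ P w * ((1 / 2) ^ w.length * 2 ^ w.length) * (1 / 2) * r := by
          rw [← mul_pow, one_div, ENNReal.inv_mul_cancel (by simp) (by simp), one_pow,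
            div_eq_mul_inv]
          ring
      _ = throughCost μ P w * 2 ^ w.length * (1 / 2) * (r * (1 / 2) ^ w.length) := by ring
      _ ≤ _ := by gcongr
  rw [ENNReal.tsum_mul_left, htop, ENNReal.mul_top (by simp [hr])] at hle
  simp at hle

end Main

/-- The Lebesgue null ideal on Cantor space is not a strongly linked tree ideal:
if `P` is a tree forcing on `2^{<ω}` such that every `I_P`-positive Borel set contains
some `[S]` (`S ∈ P`) modulo `I_P`, and `I_P` is the ideal of `μ`-null sets for the
coin-tossing measure `μ`, then `P` is not strongly linked. -/
theorem stmt13 (μ : Measure (ℕ → Bool))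
    (hμ : ∀ s : List Bool, μ (Cyl s) = (1 / 2 : ℝ≥0∞) ^ s.length)
    (P : Set (Set (List Bool))) (hP : IsTreeForcing P)
    (hchar : ∀ B : Set (ℕ → Bool), MeasurableSet B → ¬ PIdeal P B →
      ∃ S ∈ P, PIdeal P (branches S \ B))
    (hnull : ∀ A : Set (ℕ → Bool), PIdeal P A ↔ μ A = 0) :
    ¬ StronglyLinked P := by
  intro hlink
  have hprob : IsProbabilityMeasure μ := ⟨by
    have h := hμ []
    rwa [show Cyl ([] : List Bool) = Set.univ from Set.eq_univ_of_forall fun x => by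
      simp [Cyl, res], List.length_nil, pow_zero] at h⟩
  obtain ⟨v, hv⟩ := exists_killCost_ne_zero hP hnull
  obtain ⟨r, hr, hrv⟩ : ∃ r : ℝ≥0∞, r ≠ 0 ∧ r * μ (Cyl v) < killCost μ P v := by
    obtain ⟨r, hr, hr'⟩ := ENNReal.exists_nnreal_pos_mul_lt (measure_ne_top μ (Cyl v)) hv
    exact ⟨r, by exact_mod_cast hr.ne', hr'⟩
  set D := Cyl v \ ⋃ u : {u : List Bool // v <+: u ∧ killCost μ P u < r * μ (Cyl u)}, Cyl u.1
    with hD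
  have hDmeas : MeasurableSet D :=
    (measurableSet_cyl v).diff (MeasurableSet.iUnion fun u => measurableSet_cyl _)
  have hDpos : μ D ≠ 0 := measure_cyl_diff_iUnion_ne_zero hP hrv
  have hDhalf : μ D / 2 ≠ 0 := by simp [hDpos]
  have htail := ENNReal.tendsto_tsum_compl_atTop_zero (tsum_throughCost_ne_top hμ hP hr)
  obtain ⟨s, hs⟩ := (htail.eventually_lt_const (pos_iff_ne_zero.2 hDhalf)).exists
  obtain ⟨ε, hε, hεsum⟩ := ENNReal.exists_pos_sum_of_countable' hDhalf
    {w : {w : List Bool // r * μ (Cyl w) ≤ killCost μ P w} // w ∉ s}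
  have hlt : ∀ w : {w : {w : List Bool // r * μ (Cyl w) ≤ killCost μ P w} // w ∉ s},
      throughCost μ P w.1.1 < throughCost μ P w.1.1 + ε w := fun w =>
    ENNReal.lt_add_right ((throughCost_le_cyl hP _).trans_lt (measure_lt_top μ _)).ne (hε w).ne'
  choose S hS hSμ using fun w => exists_through_of_throughCost_lt (hlt w)
  set A := ⋃ w, branches (S w) ∩ Cyl w.1.1 with hA
  have hAmeas : MeasurableSet A := MeasurableSet.iUnion fun w =>
    (isClosed_branches _).measurableSet.inter (measurableSet_cyl _)
  have hAμ : μ A < μ D :=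
    calc μ A ≤ ∑' w, μ (branches (S w) ∩ Cyl w.1.1) := measure_iUnion_le _
      _ ≤ ∑' w, (throughCost μ P w.1.1 + ε w) := ENNReal.tsum_le_tsum fun w => (hSμ w).le
      _ = (∑' w : {w : {w : List Bool // r * μ (Cyl w) ≤ killCost μ P w} // w ∉ s},
          throughCost μ P w.1.1) + ∑' w, ε w := ENNReal.tsum_add
      _ < μ D / 2 + μ D / 2 := ENNReal.add_lt_add hs hεsum
      _ = μ D := ENNReal.add_halves _
  have hpos : μ (D \ A) ≠ 0 := fun h => hAμ.not_ge <|
    tsub_eq_zero_iff_le.1 <| le_zero_iff.1 <| le_measure_sdiff.trans h.le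
  obtain ⟨R, hR, t, ht, hlen, hsub⟩ := exists_isStem_branches_subset hP hnull
    (hDmeas.diff hAmeas) hpos (max v.length (s.sup (fun w => w.1.length) + 1))
  obtain ⟨x, hxR, hxt⟩ := (hP.1 R hR).exists_branch ht.1
  have hxD := (hsub hxR).1
  have hvt : v <+: t := prefix_of_mem_cyl hxD.1 hxt ((le_max_left _ _).trans hlen)
  have hgood : r * μ (Cyl t) ≤ killCost μ P t := by
    by_contra! hbad
    exact hxD.2 (Set.mem_iUnion.2 ⟨⟨t, hvt, hbad⟩, hxt⟩)
  have hts : (⟨t, hgood⟩ : {w : List Bool // r * μ (Cyl w) ≤ killCost μ P w}) ∉ s := fun hmem =>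
    absurd (Finset.le_sup (f := fun w : {w : List Bool // r * μ (Cyl w) ≤ killCost μ P w} =>
      w.1.length) hmem) (not_le.2 ((le_max_right _ _).trans hlen))
  obtain ⟨y, hyR, hyS⟩ := hlink.branches_inter_nonempty hP hR ht (hS ⟨⟨t, hgood⟩, hts⟩)
  exact (hsub hyR).2 (Set.mem_iUnion.2 ⟨_, hyS⟩)
end
end

section
/- Let A = { f ∈ ω^ω : f(n) even for all n }. Then A = [S] for a Laver tree S, and no x ∈ A is an I_L-shift density point of A: for every x ∈ A and all n, with T the Laver tree of all sequences with only odd values (empty stem), σ_{x↾n}([T]) ∩ A = ∅. Hence the I_L-shift density property fails for Laver and Miller forcing. -/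
open Set

noncomputable section

/-- The shift `σ_s : y ↦ s⌢y` by the finite string `s`. -/
def shiftMap {α : Type*} (s : List α) (x : ℕ → α) : ℕ → α :=
  fun n => if h : n < s.length then s.get ⟨n, h⟩ else x (n - s.length)

/-- The set of `I_P`-shift density points of `A`, relative to the large sets
`L = { [T] : T ∈ P, stem(T) = ∅ }`. -/
def densityPts {α : Type*} (P : Set (Set (List α))) (A : Set (ℕ → α)) : Set (ℕ → α) :=
  {x | ∃ m : ℕ, ∀ n ≥ m, ∀ T ∈ P, IsStem T [] →
    ¬ PIdeal P (shiftMap (res x n) '' branches T ∩ A)}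

/-- Laver forcing: trees `T ⊆ ω^{<ω}` with a stem above which every node has
infinitely many immediate successors. -/
def LaverForcing : Set (Set (List ℕ)) :=
  {T | IsTree T ∧ ∃ s ∈ T, (∀ t ∈ T, s <+: t ∨ t <+: s) ∧
    ∀ t ∈ T, s <+: t → {a : ℕ | t ++ [a] ∈ T}.Infinite}

/-- Miller forcing: superperfect trees, i.e. trees with an infinitely splitting node
above every node. -/
def MillerForcing : Set (Set (List ℕ)) :=
  {T | IsTree T ∧ T.Nonempty ∧
    ∀ s ∈ T, ∃ t ∈ T, s <+: t ∧ {a : ℕ | t ++ [a] ∈ T}.Infinite}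

/-- The set `A = { f ∈ ω^ω : f(n) is even for all n }`. -/
def AEven : Set (ℕ → ℕ) := {f | ∀ n : ℕ, Even (f n)}

/-- The Laver tree of all finite sequences with only odd values. -/
def OddTree : Set (List ℕ) := {t | ∀ n : ℕ, ∀ h : n < t.length, Odd (t.get ⟨n, h⟩)}

/-- A perfect tree contains arbitrarily long nodes. -/
theorem IsPerfectTree.exists_le_length {α : Type*} {T : Set (List α)} (hT : IsPerfectTree T)
    (n : ℕ) : ∃ u ∈ T, n ≤ u.length := by
  obtain ⟨-, ⟨s, hs⟩, hsplit⟩ := hT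
  induction n with
  | zero => exact ⟨s, hs, Nat.zero_le _⟩
  | succ n ih =>
    obtain ⟨u, hu, hn⟩ := ih
    obtain ⟨t, -, hut, a, -, -, ha, -⟩ := hsplit u hu
    refine ⟨t ++ [a], ha, ?_⟩
    have := hut.length_le
    simp only [List.length_append, List.length_singleton]
    omega

theorem PIdeal.mono {α : Type*} {P : Set (Set (List α))} {A B : Set (ℕ → α)}
    (hB : PIdeal P B) (h : A ⊆ B) : PIdeal P A := by
  obtain ⟨f, hf, hsub⟩ := hB
  exact ⟨f, hf, h.trans hsub⟩

theorem PIdeal.empty {α : Type*} (P : Set (Set (List α))) : PIdeal P (∅ : Set (ℕ → α)) :=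
  ⟨fun _ => ∅, fun _ T hT => ⟨T, hT, Subset.rfl, inter_empty _⟩, empty_subset _⟩

/-- An increasing sequence of finite sequences of unbounded length has a limit. -/
theorem exists_res_prefix {α : Type*} (u : ℕ → List α) (hu : ∀ n, u n <+: u (n + 1))
    (hlen : ∀ n, n ≤ (u n).length) : ∃ x : ℕ → α, ∀ k m, k ≤ m → res x k <+: u m := by
  have hmono : ∀ {i j}, i ≤ j → u i <+: u j := by
    intro i j hij
    induction j, hij using Nat.le_induction with
    | base => exact List.prefix_rfl
    | succ j _ ih => exact ih.trans (hu j)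
  refine ⟨fun k => (u (k + 1))[k]'(hlen (k + 1)), fun k m hkm => ?_⟩
  rw [List.prefix_iff_getElem]
  refine ⟨by simpa [res] using hkm.trans (hlen m), fun i hi => ?_⟩
  have hik : i < k := by simpa [res] using hi
  simpa [res] using (hmono (show i + 1 ≤ m by omega)).getElem (hlen (i + 1))

/-- The branch set of a condition of a tree forcing is not covered by countably many
`P`-nowhere dense sets. -/
theorem IsTreeForcing.not_pIdeal_branches {α : Type*} {P : Set (Set (List α))}
    (hP : IsTreeForcing P) {T : Set (List α)} (hT : T ∈ P) : ¬ PIdeal P (branches T) := by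
  obtain ⟨hperf, -, hrestr⟩ := hP
  rintro ⟨f, hf, hcover⟩
  have hstep : ∀ n : ℕ, ∀ p : {p : Set (List α) × List α // p.1 ∈ P ∧ p.2 ∈ p.1},
      ∃ q : {p : Set (List α) × List α // p.1 ∈ P ∧ p.2 ∈ p.1},
        q.1.1 ⊆ p.1.1 ∧ branches q.1.1 ∩ f n = ∅ ∧ p.1.2 <+: q.1.2 ∧ n + 1 ≤ q.1.2.length := by
    rintro n ⟨⟨R, u⟩, hR, hu⟩
    obtain ⟨S, hS, hSR, hdisj⟩ := hf n _ (hrestr R hR u hu)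
    obtain ⟨v, hv, hlen⟩ := (hperf S hS).exists_le_length (max (u.length) (n + 1))
    refine ⟨⟨(S, v), hS, hv⟩, fun t ht => (hSR ht).1, hdisj, ?_, le_of_max_le_right hlen⟩
    rcases (hSR hv).2 with h | h
    · exact h
    · exact List.prefix_of_prefix_length_le List.prefix_rfl h (le_of_max_le_left hlen)
  choose next hsub hdisj hpre hlen using hstep
  obtain ⟨u₀, hu₀⟩ := (hperf T hT).2.1
  let p : ℕ → {p : Set (List α) × List α // p.1 ∈ P ∧ p.2 ∈ p.1} :=
    fun n => Nat.rec ⟨(T, u₀), hT, hu₀⟩ next n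
  have hanti : Antitone fun n => (p n).1.1 := antitone_nat_of_succ_le fun n => hsub n (p n)
  obtain ⟨x, hx⟩ := exists_res_prefix (fun n => (p n).1.2) (fun n => hpre n (p n))
    (fun n => by
      cases n with
      | zero => exact Nat.zero_le _
      | succ n => exact hlen n (p n))
  have hmem : ∀ n, x ∈ branches (p n).1.1 := fun n k =>
    (hperf _ (p n).2.1).1 _ (hanti (le_max_right k n) (p (max k n)).2.2) _
      (hx k _ (le_max_left k n))
  obtain ⟨n, hn⟩ := mem_iUnion.1 (hcover (hmem 0))
  exact (hdisj n (p n)).subset ⟨hmem (n + 1), hn⟩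

theorem laverForcing_subset_millerForcing : LaverForcing ⊆ MillerForcing := by
  rintro T ⟨hT, r, hr, hcomp, hinf⟩
  refine ⟨hT, ⟨r, hr⟩, fun s hs => ?_⟩
  rcases hcomp s hs with h | h
  · exact ⟨s, hs, List.prefix_rfl, hinf s hs h⟩
  · exact ⟨r, hr, h, hinf r hr List.prefix_rfl⟩

theorem isPerfectTree_of_mem_millerForcing {T : Set (List ℕ)} (hT : T ∈ MillerForcing) :
    IsPerfectTree T := by
  refine ⟨hT.1, hT.2.1, fun s hs => ?_⟩
  obtain ⟨t, ht, hst, hinf⟩ := hT.2.2 s hs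
  obtain ⟨a, ha, b, hb, hab⟩ := hinf.nontrivial
  exact ⟨t, ht, hst, a, b, hab, ha, hb⟩

/-- The tree of finite sequences all of whose values satisfy `p` is a Laver tree as soon as
`p` holds infinitely often. -/
theorem setOf_forall_mem_mem_laverForcing {p : ℕ → Prop} (hp : {a | p a}.Infinite) :
    {t : List ℕ | ∀ a ∈ t, p a} ∈ LaverForcing := by
  refine ⟨fun s hs t hts a ha => hs a (hts.subset ha), [], by simp,
    fun t _ => Or.inl List.nil_prefix, fun t ht _ => hp.mono fun a ha => ?_⟩
  intro b hb
  rcases List.mem_append.1 hb with hb | hb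
  · exact ht b hb
  · rw [List.mem_singleton.1 hb]
    exact ha

theorem branches_setOf_forall_mem {α : Type*} (p : α → Prop) :
    branches {t : List α | ∀ a ∈ t, p a} = {f | ∀ n, p (f n)} := by
  ext f
  simp only [branches, res, mem_ofPred_eq, List.forall_mem_ofFn_iff]
  exact ⟨fun h n => h (n + 1) (Fin.last n), fun h n i => h i⟩

theorem isTree_restrict {α : Type*} {T : Set (List α)} (hT : IsTree T) (u : List α) :
    IsTree {t ∈ T | u <+: t ∨ t <+: u} := by
  rintro s ⟨hs, hsu⟩ t hts
  refine ⟨hT s hs t hts, ?_⟩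
  rcases hsu with h | h
  · exact List.prefix_or_prefix_of_prefix h hts
  · exact Or.inr (hts.trans h)

theorem isTreeForcing_laverForcing : IsTreeForcing LaverForcing := by
  refine ⟨fun T hT => isPerfectTree_of_mem_millerForcing (laverForcing_subset_millerForcing hT),
    ?_, ?_⟩
  · have h := setOf_forall_mem_mem_laverForcing (p := fun _ => True)
      (by simpa using Set.infinite_univ)
    simpa using h
  rintro T ⟨hT, s, hs, hcomp, hinf⟩ u hu
  refine ⟨isTree_restrict hT u, ?_⟩
  rcases hcomp u hu with h | h
  · refine ⟨u, ⟨hu, Or.inl List.prefix_rfl⟩, fun t ht => ht.2, fun t ht hut => ?_⟩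
    exact (hinf t ht.1 (h.trans hut)).mono fun a ha =>
      ⟨ha, Or.inl (hut.trans (List.prefix_append t [a]))⟩
  · refine ⟨s, ⟨hs, Or.inl h⟩, fun t ht => hcomp t ht.1, fun t ht hst => ?_⟩
    exact (hinf t ht.1 hst).mono fun a ha =>
      ⟨ha, Or.inl ((h.trans hst).trans (List.prefix_append t [a]))⟩

theorem isTreeForcing_millerForcing : IsTreeForcing MillerForcing := by
  refine ⟨fun T hT => isPerfectTree_of_mem_millerForcing hT,
    laverForcing_subset_millerForcing isTreeForcing_laverForcing.2.1, ?_⟩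
  rintro T ⟨hT, -, hsplit⟩ u hu
  have key : ∀ s ∈ T, u <+: s → ∃ t ∈ {t ∈ T | u <+: t ∨ t <+: u}, s <+: t ∧
      {a : ℕ | t ++ [a] ∈ {t ∈ T | u <+: t ∨ t <+: u}}.Infinite := by
    intro s hs hus
    obtain ⟨t, ht, hst, hinf⟩ := hsplit s hs
    have hut := hus.trans hst
    exact ⟨t, ⟨ht, Or.inl hut⟩, hst, hinf.mono fun a ha =>
      ⟨ha, Or.inl (hut.trans (List.prefix_append t [a]))⟩⟩
  refine ⟨isTree_restrict hT u, ⟨u, hu, Or.inl List.prefix_rfl⟩, fun s hs => ?_⟩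
  rcases hs.2 with h | h
  · exact key s hs.1 h
  · obtain ⟨t, ht, hut, hinf⟩ := key u hu List.prefix_rfl
    exact ⟨t, ht, h.trans hut, hinf⟩

theorem aEven_eq_branches : AEven = branches {t : List ℕ | ∀ a ∈ t, Even a} :=
  (branches_setOf_forall_mem _).symm

theorem evenTree_mem_laverForcing : {t : List ℕ | ∀ a ∈ t, Even a} ∈ LaverForcing :=
  setOf_forall_mem_mem_laverForcing
    (Set.infinite_of_injective_forall_mem (f := fun n : ℕ => 2 * n)
      (fun _ _ h => by simpa using h) fun n => even_two_mul n)

theorem oddTree_eq : OddTree = {t : List ℕ | ∀ a ∈ t, Odd a} := by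
  ext t
  simp only [OddTree, mem_ofPred_eq, List.forall_mem_iff_getElem, List.get_eq_getElem]

theorem oddTree_mem_laverForcing : OddTree ∈ LaverForcing := by
  rw [oddTree_eq]
  exact setOf_forall_mem_mem_laverForcing
    (Set.infinite_of_injective_forall_mem (f := fun n : ℕ => 2 * n + 1)
      (fun _ _ h => by simpa using h) fun n => odd_two_mul_add_one n)

theorem isStem_oddTree : IsStem OddTree [] := by
  rw [oddTree_eq]
  refine ⟨by simp, fun t _ => Or.inl List.nil_prefix, fun s hs hcomp => ?_⟩
  cases s with
  | nil => exact le_rfl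
  | cons a l =>
    have ha : Odd (a + 2) := (hs a List.mem_cons_self).add_even even_two
    have := hcomp [a + 2] (by simpa using ha)
    simp [List.cons_prefix_cons] at this

theorem shiftMap_image_oddTree_inter_aEven (s : List ℕ) :
    shiftMap s '' branches OddTree ∩ AEven = ∅ := by
  rw [oddTree_eq, branches_setOf_forall_mem, eq_empty_iff_forall_notMem]
  rintro _ ⟨⟨y, hy, rfl⟩, hmem⟩
  have h := hmem s.length
  simp only [shiftMap, lt_irrefl, dite_false, Nat.sub_self] at h
  exact Nat.not_even_iff_odd.2 (hy 0) h

/-- The shift density property fails at `AEven` for every tree forcing on `ω` that contains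
the Laver trees. -/
theorem IsTreeForcing.not_pIdeal_symmDiff_densityPts {P : Set (Set (List ℕ))}
    (hP : IsTreeForcing P) (hL : LaverForcing ⊆ P) :
    ¬ PIdeal P (symmDiff AEven (densityPts P AEven)) := by
  intro h
  refine hP.not_pIdeal_branches (hL evenTree_mem_laverForcing) ?_
  rw [← aEven_eq_branches]
  refine h.mono fun x hx => Or.inl ⟨hx, ?_⟩
  rintro ⟨m, hm⟩
  apply hm m le_rfl OddTree (hL oddTree_mem_laverForcing) isStem_oddTree
  rw [shiftMap_image_oddTree_inter_aEven]
  exact PIdeal.empty P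

/-- `A = { f : f(n) even for all n }` is the branch set of a Laver tree, but no `x ∈ A`
is an `I_L`-shift density point of `A`: with `T` the Laver tree of sequences with only
odd values (which has empty stem), `σ_{x↾n}([T]) ∩ A = ∅` for all `n`. Hence the
`I_L`-shift density property fails for Laver and Miller forcing. -/
theorem stmt15 :
    (∃ S ∈ LaverForcing, AEven = branches S) ∧
    OddTree ∈ LaverForcing ∧ IsStem OddTree [] ∧
    (∀ x ∈ AEven, ∀ n : ℕ, shiftMap (res x n) '' branches OddTree ∩ AEven = ∅) ∧
    ¬ PIdeal LaverForcing (symmDiff AEven (densityPts LaverForcing AEven)) ∧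
    ¬ PIdeal MillerForcing (symmDiff AEven (densityPts MillerForcing AEven)) := by
  exact ⟨⟨_, evenTree_mem_laverForcing, aEven_eq_branches⟩, oddTree_mem_laverForcing,
    isStem_oddTree, fun x _ n => shiftMap_image_oddTree_inter_aEven (res x n),
    isTreeForcing_laverForcing.not_pIdeal_symmDiff_densityPts Subset.rfl,
    isTreeForcing_millerForcing.not_pIdeal_symmDiff_densityPts
      laverForcing_subset_millerForcing⟩
end
end
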